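/- arXiv:1809.08154 — 6 statements merged into one kernel-verified Lean document; each statement's English description precedes it below -/
import Mathlib

section
/- Suppose n ≥ 2 and every variable occurs in at least one clause of φ. Then every automorphism of the graph G_φ fixes setwise each of the following sets of vertices: the set S = {i_s : 1 ≤ i < n}, the set R = {i_r : 1 ≤ i < n}, the set L = {i_l : 1 ≤ i < n}, the set 𝒞 of all clause vertices, and the set 𝒳 of all variable vertices. -/
open SimpleGraph

/-- A homogeneous 3-XOR formula over the `n` variables `X_0 < X_1 < … < X_{n-1}`:
a finite set of pairwise distinct clauses, each clause being a 3-element subset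
of the variables (given as a triple listed in increasing order) and encoding the
equation `x + y + z = 0` over the field `𝔽₂`. -/
structure HomXor (n : ℕ) : Type where
  clauses : Finset (Fin n × Fin n × Fin n)
  ordered : ∀ c ∈ clauses, c.1 < c.2.1 ∧ c.2.1 < c.2.2

namespace HomXor

variable {n : ℕ}

/-- The assignment `T` satisfies `φ`: in every clause the three variables sum
to `0` over `𝔽₂`. -/
def Satisfies (φ : HomXor n) (T : Fin n → ZMod 2) : Prop :=
  ∀ c ∈ φ.clauses, T c.1 + T c.2.1 + T c.2.2 = 0

/-- The variable `x` occurs in at least one clause of `φ`. -/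
def OccursIn (φ : HomXor n) (x : Fin n) : Prop :=
  ∃ c ∈ φ.clauses, x = c.1 ∨ x = c.2.1 ∨ x = c.2.2

/-- The vertices of the graph `G_φ`:
* `cl c a b` is the clause vertex `C_{a b (a+b)}` — note that
  `{C_{000}, C_{011}, C_{110}, C_{101}}` is exactly the set of `C_{a b c}`
  with `a + b + c = 0` in `𝔽₂`, so the four clause vertices of `C` are
  `cl c a b` for `(a, b) ∈ 𝔽₂ × 𝔽₂`;
* `var x v` is the variable vertex `X_x^v`;
* `lt i`, `rt i`, `st i` are the vertices `i_l`, `i_r`, `i_s` — here `i`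
  ranges over `Fin (n-1)`, with `i : Fin (n-1)` representing the paper's
  (1-based) index `i+1`, so in terms of 0-based variable indices the vertex
  `lt i` is attached to the variable `i` and `rt i` to the variable `i+1`. -/
inductive Vtx (φ : HomXor n) : Type
  | cl (c : {c // c ∈ φ.clauses}) (a b : ZMod 2)
  | var (x : Fin n) (v : ZMod 2)
  | lt (i : Fin (n - 1))
  | rt (i : Fin (n - 1))
  | st (i : Fin (n - 1))
  deriving DecidableEq

/-- The variable attached to `i_l` (the paper's `X_i`), as an element of `Fin n`. -/
def low (i : Fin (n - 1)) : Fin n := ⟨i.1, lt_of_lt_of_le i.2 (Nat.sub_le n 1)⟩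

/-- The variable attached to `i_r` (the paper's `X_{i+1}`), as an element of `Fin n`. -/
def high (i : Fin (n - 1)) : Fin n := ⟨i.1 + 1, by have := i.2; omega⟩

/-- The edges of the graph `G_φ`.  For a clause `C` with variables
`x < y < z`, the clause vertex `C_{a b (a+b)}` is adjacent to `x^{1+a}`,
`y^{1+b}` and `z^{1+a+b}` (this is exactly: `C_{000}` adjacent to
`x^1, y^1, z^1`; `C_{011}` to `x^1, y^0, z^0`; `C_{110}` to `x^0, y^0, z^1`;
`C_{101}` to `x^0, y^1, z^0`).  For each variable `X` there is an edge between
`X^0` and `X^1`, and for each `i` there are the asymmetry-gadget edges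
`{i_l, i_r}`, `{i_r, i_s}`, `{i_l, X_i^0}`, `{i_l, X_i^1}`, `{i_r, X_{i+1}^0}`,
`{i_r, X_{i+1}^1}`. -/
inductive Edge (φ : HomXor n) : Vtx φ → Vtx φ → Prop
  | cx (c : {c // c ∈ φ.clauses}) (a b : ZMod 2) :
      Edge φ (Vtx.cl c a b) (Vtx.var c.1.1 (1 + a))
  | cy (c : {c // c ∈ φ.clauses}) (a b : ZMod 2) :
      Edge φ (Vtx.cl c a b) (Vtx.var c.1.2.1 (1 + b))
  | cz (c : {c // c ∈ φ.clauses}) (a b : ZMod 2) :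
      Edge φ (Vtx.cl c a b) (Vtx.var c.1.2.2 (1 + a + b))
  | xx (x : Fin n) : Edge φ (Vtx.var x 0) (Vtx.var x 1)
  | lr (i : Fin (n - 1)) : Edge φ (Vtx.lt i) (Vtx.rt i)
  | rs (i : Fin (n - 1)) : Edge φ (Vtx.rt i) (Vtx.st i)
  | lv (i : Fin (n - 1)) (v : ZMod 2) : Edge φ (Vtx.lt i) (Vtx.var (low i) v)
  | rv (i : Fin (n - 1)) (v : ZMod 2) : Edge φ (Vtx.rt i) (Vtx.var (high i) v)

/-- The graph `G_φ`. -/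
def G (φ : HomXor n) : SimpleGraph (Vtx φ) := SimpleGraph.fromRel (Edge φ)

end HomXor

namespace HomXor

variable {n : ℕ} {φ : HomXor n}

theorem Edge.ne {u v : Vtx φ} (h : Edge φ u v) : u ≠ v := by
  cases h <;> simp

theorem adj_iff {u v : Vtx φ} : (G φ).Adj u v ↔ Edge φ u v ∨ Edge φ v u := by
  rw [G, SimpleGraph.fromRel_adj]
  exact ⟨And.right, fun h => ⟨h.elim Edge.ne fun h => h.ne.symm, h⟩⟩

theorem Edge.adj {u v : Vtx φ} (h : Edge φ u v) : (G φ).Adj u v := adj_iff.2 (.inl h)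

theorem Edge.adj_symm {u v : Vtx φ} (h : Edge φ u v) : (G φ).Adj v u := h.adj.symm

theorem neighborSet_st (i : Fin (n - 1)) :
    (G φ).neighborSet (Vtx.st i) ⊆ {Vtx.rt i} := by
  intro w hw
  rcases adj_iff.1 hw with h | h <;> cases h
  simp

theorem neighborSet_lt (i : Fin (n - 1)) :
    (G φ).neighborSet (Vtx.lt i) ⊆ {Vtx.rt i, Vtx.var (low i) 0, Vtx.var (low i) 1} := by
  intro w hw
  rcases adj_iff.1 hw with h | h <;> cases h
  · simp
  · rename_i v
    fin_cases v
    · exact .inr (.inl rfl)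
    · exact .inr (.inr rfl)

theorem neighborSet_cl (c : {c // c ∈ φ.clauses}) (a b : ZMod 2) :
    (G φ).neighborSet (Vtx.cl c a b) ⊆
      {Vtx.var c.1.1 (1 + a), Vtx.var c.1.2.1 (1 + b), Vtx.var c.1.2.2 (1 + a + b)} := by
  intro w hw
  rcases adj_iff.1 hw with h | h <;> cases h <;> simp

theorem encard_insert_pair_le {V : Type*} (a b c : V) : ({a, b, c} : Set V).encard ≤ 3 :=
  (Set.encard_insert_le _ _).trans <| by
    grw [Set.encard_insert_le, Set.encard_singleton]
    norm_num

/-- A variable occurring in a clause is adjacent, in either polarity, to two clause vertices. -/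
theorem OccursIn.exists_adj_cl {x : Fin n} (h : φ.OccursIn x) (v : ZMod 2) :
    ∃ c a b a' b', (Vtx.cl c a b : Vtx φ) ≠ Vtx.cl c a' b' ∧
      (G φ).Adj (Vtx.var x v) (Vtx.cl c a b) ∧ (G φ).Adj (Vtx.var x v) (Vtx.cl c a' b') := by
  obtain ⟨c, hc, rfl | rfl | rfl⟩ := h
  · have key (b : ZMod 2) : Edge φ (Vtx.cl ⟨c, hc⟩ (1 + v) b) (Vtx.var c.1 v) := by
      have := Edge.cx ⟨c, hc⟩ (1 + v) b
      rwa [← add_assoc, CharTwo.add_self_eq_zero, zero_add] at this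
    exact ⟨⟨c, hc⟩, 1 + v, 0, 1 + v, 1, by simp, (key 0).adj_symm, (key 1).adj_symm⟩
  · have key (a : ZMod 2) : Edge φ (Vtx.cl ⟨c, hc⟩ a (1 + v)) (Vtx.var c.2.1 v) := by
      have := Edge.cy ⟨c, hc⟩ a (1 + v)
      rwa [← add_assoc, CharTwo.add_self_eq_zero, zero_add] at this
    exact ⟨⟨c, hc⟩, 0, 1 + v, 1, 1 + v, by simp, (key 0).adj_symm, (key 1).adj_symm⟩
  · have key (a : ZMod 2) : Edge φ (Vtx.cl ⟨c, hc⟩ a (1 + a + v)) (Vtx.var c.2.2 v) := by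
      have := Edge.cz ⟨c, hc⟩ a (1 + a + v)
      rwa [← add_assoc, CharTwo.add_self_eq_zero, zero_add] at this
    exact ⟨⟨c, hc⟩, 0, _, 1, _, by simp, (key 0).adj_symm, (key 1).adj_symm⟩

theorem adj_var_flip (x : Fin n) (v : ZMod 2) :
    (G φ).Adj (Vtx.var x v) (Vtx.var x (1 + v)) := by
  fin_cases v
  · exact (Edge.xx x).adj
  · exact (Edge.xx x).adj_symm

/-- When `n ≥ 2`, each variable vertex is attached to some `i_l` or `i_r`. -/
theorem exists_adj_gadget (hn : 2 ≤ n) (x : Fin n) (v : ZMod 2) :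
    ∃ i, (G φ).Adj (Vtx.var x v) (Vtx.lt i) ∨ (G φ).Adj (Vtx.var x v) (Vtx.rt i) := by
  by_cases hx : x.1 < n - 1
  · exact ⟨⟨x, hx⟩, .inl (Edge.lv ⟨x, hx⟩ v).adj_symm⟩
  · have hx' : x.1 - 1 < n - 1 := by omega
    have hhigh : high ⟨x.1 - 1, hx'⟩ = x := Fin.ext (by simp only [high]; omega)
    have := (Edge.rv (φ := φ) ⟨x.1 - 1, hx'⟩ v).adj_symm
    rw [hhigh] at this
    exact ⟨_, .inr this⟩

theorem three_lt_encard {V : Type*} {s : Set V} {a b c d : V}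
    (ha : a ∈ s) (hb : b ∈ s) (hc : c ∈ s) (hd : d ∈ s) (hab : a ≠ b) (hac : a ≠ c)
    (had : a ≠ d) (hbc : b ≠ c) (hbd : b ≠ d) (hcd : c ≠ d) : 3 < s.encard := by
  have hsub : ({a, b, c, d} : Set V) ⊆ s := by
    rintro x (rfl | rfl | rfl | rfl) <;> assumption
  refine lt_of_lt_of_le ?_ (Set.encard_le_encard hsub)
  rw [Set.encard_insert_of_notMem (by simp [hab, hac, had]),
    Set.encard_insert_of_notMem (by simp [hbc, hbd]), Set.encard_pair hcd]
  norm_num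

theorem three_lt_encard_rt (i : Fin (n - 1)) :
    3 < ((G φ).neighborSet (Vtx.rt i)).encard :=
  three_lt_encard (a := Vtx.lt i) (b := Vtx.st i) (Edge.lr i).adj_symm (Edge.rs i).adj
    (Edge.rv i 0).adj (Edge.rv i 1).adj (by simp) (by simp) (by simp) (by simp) (by simp) (by simp)

theorem three_lt_encard_var (hn : 2 ≤ n) {x : Fin n} (hx : φ.OccursIn x) (v : ZMod 2) :
    3 < ((G φ).neighborSet (Vtx.var x v)).encard := by
  obtain ⟨c, a, b, a', b', hne, h₁, h₂⟩ := hx.exists_adj_cl v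
  obtain ⟨i, h | h⟩ := exists_adj_gadget (φ := φ) hn x v <;>
    exact three_lt_encard h₁ h₂ h (adj_var_flip x v) hne (by simp) (by simp) (by simp) (by simp)
      (by simp)

theorem exists_eq_st_iff (hn : 2 ≤ n) (hocc : ∀ x : Fin n, φ.OccursIn x) (v : Vtx φ) :
    (∃ i, v = Vtx.st i) ↔ ((G φ).neighborSet v).encard ≤ 1 := by
  constructor
  · rintro ⟨i, rfl⟩
    exact (Set.encard_le_encard (neighborSet_st i)).trans (Set.encard_singleton _).le
  · intro h
    cases v with
    | st i => exact ⟨i, rfl⟩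
    | rt i => exact absurd (h.trans (by norm_num)) (three_lt_encard_rt i).not_ge
    | var x v => exact absurd (h.trans (by norm_num)) (three_lt_encard_var hn (hocc x) v).not_ge
    | lt i =>
      have := Set.encard_le_one_iff.1 h _ _ (Edge.lr i).adj (Edge.lv i 0).adj
      simp at this
    | cl c a b =>
      have := Set.encard_le_one_iff.1 h _ _ (Edge.cx c a b).adj (Edge.cy c a b).adj
      simp [(φ.ordered c.1 c.2).1.ne] at this

theorem exists_eq_rt_iff (v : Vtx φ) :
    (∃ i, v = Vtx.rt i) ↔ ∃ u, (G φ).Adj v u ∧ ∃ i, u = Vtx.st i := by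
  constructor
  · rintro ⟨i, rfl⟩
    exact ⟨_, (Edge.rs i).adj, i, rfl⟩
  · rintro ⟨_, h, i, rfl⟩
    exact ⟨i, neighborSet_st i h.symm⟩

theorem exists_eq_var_iff (hn : 2 ≤ n) (hocc : ∀ x : Fin n, φ.OccursIn x) (v : Vtx φ) :
    (∃ x w, v = Vtx.var x w) ↔
      3 < ((G φ).neighborSet v).encard ∧ ¬ ∃ i, v = Vtx.rt i := by
  cases v with
  | var x w => simpa using three_lt_encard_var hn (hocc x) w
  | rt i => simp
  | st i => simpa using (Set.encard_le_encard (neighborSet_st (φ := φ) i)).trans (by simp)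
  | lt i =>
    simpa using (Set.encard_le_encard (neighborSet_lt (φ := φ) i)).trans
      (encard_insert_pair_le _ _ _)
  | cl c a b =>
    simpa using (Set.encard_le_encard (neighborSet_cl c a b)).trans (encard_insert_pair_le _ _ _)

theorem exists_eq_lt_iff (v : Vtx φ) :
    (∃ i, v = Vtx.lt i) ↔ (∃ u, (G φ).Adj v u ∧ ∃ i, u = Vtx.rt i) ∧
      (¬ ∃ i, v = Vtx.st i) ∧ ¬ ∃ x w, v = Vtx.var x w := by
  constructor
  · rintro ⟨i, rfl⟩
    exact ⟨⟨_, (Edge.lr i).adj, i, rfl⟩, by simp, by simp⟩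
  · rintro ⟨⟨_, h, i, rfl⟩, hst, hvar⟩
    rcases adj_iff.1 h with h | h <;> cases h
    · exact ⟨i, rfl⟩
    · exact absurd ⟨i, rfl⟩ hst
    · exact absurd ⟨_, _, rfl⟩ hvar

theorem exists_eq_cl_iff (v : Vtx φ) :
    (∃ c a b, v = Vtx.cl c a b) ↔ (¬ ∃ i, v = Vtx.st i) ∧ (¬ ∃ i, v = Vtx.rt i) ∧
      (¬ ∃ i, v = Vtx.lt i) ∧ ¬ ∃ x w, v = Vtx.var x w := by
  cases v <;> simp

end HomXor

theorem SimpleGraph.Iso.encard_neighborSet {V W : Type*} {G : SimpleGraph V} {H : SimpleGraph W}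
    (f : G ≃g H) (v : V) : (H.neighborSet (f v)).encard = (G.neighborSet v).encard :=
  (Set.encard_congr (f.mapNeighborSet v)).symm

theorem SimpleGraph.Iso.exists_adj_apply_iff {V W : Type*} {G : SimpleGraph V}
    {H : SimpleGraph W} (f : G ≃g H) {p : V → Prop} {q : W → Prop} (h : ∀ v, q (f v) ↔ p v)
    (v : V) : (∃ u, H.Adj (f v) u ∧ q u) ↔ ∃ u, G.Adj v u ∧ p u := by
  simp [f.surjective.exists, f.map_adj_iff, h]

theorem SimpleGraph.Iso.image_setOf_eq {V : Type*} {G : SimpleGraph V} (f : G ≃g G)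
    {p : V → Prop} (h : ∀ v, p (f v) ↔ p v) : f '' {v | p v} = {v | p v} := by
  ext w
  obtain ⟨v, rfl⟩ := f.surjective w
  simp [h]

open HomXor in
/-- If `n ≥ 2` and every variable occurs in at least one clause of `φ`, then
every automorphism of `G_φ` fixes setwise each of the sets
`S = {i_s}`, `R = {i_r}`, `L = {i_l}`, the set of clause vertices and the set
of variable vertices. -/
theorem automorphism_fixes_classes_setwise {n : ℕ} (φ : HomXor n) (hn : 2 ≤ n)
    (hocc : ∀ x : Fin n, φ.OccursIn x) (α : G φ ≃g G φ) :
    (⇑α '' {v : Vtx φ | ∃ i, v = Vtx.st i} = {v : Vtx φ | ∃ i, v = Vtx.st i}) ∧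
    (⇑α '' {v : Vtx φ | ∃ i, v = Vtx.rt i} = {v : Vtx φ | ∃ i, v = Vtx.rt i}) ∧
    (⇑α '' {v : Vtx φ | ∃ i, v = Vtx.lt i} = {v : Vtx φ | ∃ i, v = Vtx.lt i}) ∧
    (⇑α '' {v : Vtx φ | ∃ c a b, v = Vtx.cl c a b} =
      {v : Vtx φ | ∃ c a b, v = Vtx.cl c a b}) ∧
    (⇑α '' {v : Vtx φ | ∃ x w, v = Vtx.var x w} =
      {v : Vtx φ | ∃ x w, v = Vtx.var x w}) := by
  have hst (v : Vtx φ) : (∃ i, α v = Vtx.st i) ↔ ∃ i, v = Vtx.st i := by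
    rw [exists_eq_st_iff hn hocc, exists_eq_st_iff hn hocc, α.encard_neighborSet]
  have hrt (v : Vtx φ) : (∃ i, α v = Vtx.rt i) ↔ ∃ i, v = Vtx.rt i := by
    rw [exists_eq_rt_iff, exists_eq_rt_iff]
    exact α.exists_adj_apply_iff hst v
  have hvar (v : Vtx φ) : (∃ x w, α v = Vtx.var x w) ↔ ∃ x w, v = Vtx.var x w := by
    rw [exists_eq_var_iff hn hocc, exists_eq_var_iff hn hocc, α.encard_neighborSet, hrt]
  have hlt (v : Vtx φ) : (∃ i, α v = Vtx.lt i) ↔ ∃ i, v = Vtx.lt i := by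
    rw [exists_eq_lt_iff, exists_eq_lt_iff, hst, hvar]
    exact and_congr_left' (α.exists_adj_apply_iff hrt v)
  have hcl (v : Vtx φ) : (∃ c a b, α v = Vtx.cl c a b) ↔ ∃ c a b, v = Vtx.cl c a b := by
    rw [exists_eq_cl_iff, exists_eq_cl_iff, hst, hrt, hlt, hvar]
  exact ⟨α.image_setOf_eq hst, α.image_setOf_eq hrt, α.image_setOf_eq hlt,
    α.image_setOf_eq hcl, α.image_setOf_eq hvar⟩
end

section
/- Suppose n ≥ 2 and every variable occurs in at least one clause of φ. Then for every automorphism α of the graph G_φ and every variable X, α maps the set {X^0, X^1} to itself; that is, α either fixes both vertices X^0 and X^1 or interchanges them. -/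
open SimpleGraph

namespace HomXor

variable {n : ℕ} {φ : HomXor n}

lemma adj_st {i : Fin (n - 1)} {v : Vtx φ} : (G φ).Adj (Vtx.st i) v ↔ v = Vtx.rt i := by
  rw [G, SimpleGraph.fromRel_adj]
  constructor
  · rintro ⟨-, h | h⟩ <;> cases h
    rfl
  · rintro rfl
    exact ⟨by simp, Or.inr (Edge.rs i)⟩

lemma adj_rt {i : Fin (n - 1)} {v : Vtx φ} :
    (G φ).Adj (Vtx.rt i) v ↔
      v = Vtx.lt i ∨ v = Vtx.st i ∨ ∃ a, v = Vtx.var (high i) a := by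
  rw [G, SimpleGraph.fromRel_adj]
  constructor
  · rintro ⟨-, h | h⟩ <;> cases h <;> simp
  · rintro (rfl | rfl | ⟨a, rfl⟩)
    · exact ⟨by simp, Or.inr (Edge.lr i)⟩
    · exact ⟨by simp, Or.inl (Edge.rs i)⟩
    · exact ⟨by simp, Or.inl (Edge.rv i a)⟩

lemma adj_lt {i : Fin (n - 1)} {v : Vtx φ} :
    (G φ).Adj (Vtx.lt i) v ↔ v = Vtx.rt i ∨ ∃ a, v = Vtx.var (low i) a := by
  rw [G, SimpleGraph.fromRel_adj]
  constructor
  · rintro ⟨-, h | h⟩ <;> cases h <;> simp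
  · rintro (rfl | ⟨a, rfl⟩)
    · exact ⟨by simp, Or.inl (Edge.lr i)⟩
    · exact ⟨by simp, Or.inl (Edge.lv i a)⟩

lemma adj_var_succ (x : Fin n) (a : ZMod 2) :
    (G φ).Adj (Vtx.var x a) (Vtx.var x (a + 1)) := by
  rw [G, SimpleGraph.fromRel_adj]
  refine ⟨by simp, ?_⟩
  fin_cases a
  · exact Or.inl (Edge.xx x)
  · exact Or.inr (Edge.xx x)

lemma low_ne_high (i : Fin (n - 1)) : low i ≠ high i := by
  simp [low, high, Fin.ext_iff]

lemma exists_eq_low_or_eq_high (hn : 2 ≤ n) (x : Fin n) :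
    ∃ i : Fin (n - 1), x = low i ∨ x = high i := by
  by_cases hx : x.1 < n - 1
  · exact ⟨⟨x, hx⟩, Or.inl rfl⟩
  · exact ⟨⟨n - 2, by omega⟩, Or.inr (Fin.ext (by simp only [high]; omega))⟩

/-- The vertices `i_s` are the only ones without two distinct neighbours. -/
lemma exists_eq_st (hn : 2 ≤ n) {v : Vtx φ}
    (hv : ∀ u w, (G φ).Adj v u → (G φ).Adj v w → u = w) : ∃ i, v = Vtx.st i := by
  cases v with
  | cl c a b =>
    have hx : (G φ).Adj (Vtx.cl c a b) (Vtx.var c.1.1 (1 + a)) := by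
      rw [G, SimpleGraph.fromRel_adj]
      exact ⟨by simp, Or.inl (Edge.cx c a b)⟩
    have hy : (G φ).Adj (Vtx.cl c a b) (Vtx.var c.1.2.1 (1 + b)) := by
      rw [G, SimpleGraph.fromRel_adj]
      exact ⟨by simp, Or.inl (Edge.cy c a b)⟩
    exact absurd (Vtx.var.inj (hv _ _ hx hy)).1 (φ.ordered c.1 c.2).1.ne
  | var x a =>
    obtain ⟨i, rfl | rfl⟩ := exists_eq_low_or_eq_high hn x
    · have h := hv _ _ (adj_var_succ _ a) (adj_lt.2 (Or.inr ⟨a, rfl⟩)).symm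
      cases h
    · have h := hv _ _ (adj_var_succ _ a) (adj_rt.2 (Or.inr (Or.inr ⟨a, rfl⟩))).symm
      cases h
  | lt i =>
    have h := hv _ _ (adj_lt.2 (Or.inl rfl)) (adj_lt.2 (Or.inr ⟨0, rfl⟩))
    cases h
  | rt i =>
    have h := hv _ _ (adj_rt.2 (Or.inl rfl)) (adj_rt.2 (Or.inr (Or.inl rfl)))
    cases h
  | st i => exact ⟨i, rfl⟩

lemma not_adj_rt_and_adj_lt (i : Fin (n - 1)) (w : Vtx φ) :
    ¬ ((G φ).Adj (Vtx.rt i) w ∧ (G φ).Adj (Vtx.lt i) w) := by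
  rintro ⟨h₁, h₂⟩
  rw [adj_rt] at h₁
  rw [adj_lt] at h₂
  rcases h₂ with rfl | ⟨a, rfl⟩
  · simp at h₁
  · simp [low_ne_high] at h₁

/-- An automorphism maps each gadget, together with its two attached variable pairs, to a gadget
and its attached pairs. -/
lemma exists_map_gadget (hn : 2 ≤ n) (α : G φ ≃g G φ) (i : Fin (n - 1)) :
    ∃ j : Fin (n - 1), (∀ a, ∃ b, α (Vtx.var (low i) a) = Vtx.var (low j) b) ∧
      ∀ a, ∃ b, α (Vtx.var (high i) a) = Vtx.var (high j) b := by
  obtain ⟨j, hst⟩ : ∃ j, α (Vtx.st i) = Vtx.st j := by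
    refine exists_eq_st hn fun u w hu hw ↦ ?_
    rw [← α.apply_symm_apply u, α.map_adj_iff, adj_st] at hu
    rw [← α.apply_symm_apply w, α.map_adj_iff, adj_st] at hw
    exact α.symm.injective (hu.trans hw.symm)
  have hrt : α (Vtx.rt i) = Vtx.rt j := by
    rw [← adj_st, ← hst, α.map_adj_iff, adj_st]
  have hlt : α (Vtx.lt i) = Vtx.lt j := by
    have h : (G φ).Adj (α (Vtx.rt i)) (α (Vtx.lt i)) := α.map_adj_iff.2 (adj_rt.2 (Or.inl rfl))
    rw [hrt, adj_rt] at h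
    rcases h with h | h | ⟨a, h⟩
    · exact h
    · have h' := α.injective (h.trans hst.symm)
      cases h'
    · refine absurd ⟨?_, ?_⟩ (not_adj_rt_and_adj_lt i (α.symm (Vtx.var (high j) (a + 1))))
      · rw [← α.map_adj_iff, α.apply_symm_apply, hrt]
        exact adj_rt.2 (Or.inr (Or.inr ⟨_, rfl⟩))
      · rw [← α.map_adj_iff, α.apply_symm_apply, h]
        exact adj_var_succ _ _
  refine ⟨j, fun a ↦ ?_, fun a ↦ ?_⟩
  · have h : (G φ).Adj (α (Vtx.lt i)) (α (Vtx.var (low i) a)) :=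
      α.map_adj_iff.2 (adj_lt.2 (Or.inr ⟨a, rfl⟩))
    rw [hlt, adj_lt, ← hrt] at h
    simpa [α.injective.eq_iff] using h
  · have h : (G φ).Adj (α (Vtx.rt i)) (α (Vtx.var (high i) a)) :=
      α.map_adj_iff.2 (adj_rt.2 (Or.inr (Or.inr ⟨a, rfl⟩)))
    rw [hrt, adj_rt, ← hlt, ← hst] at h
    simpa [α.injective.eq_iff] using h

lemma exists_map_var_eq (hn : 2 ≤ n) (α : G φ ≃g G φ) (x : Fin n) (a : ZMod 2) :
    ∃ b, α (Vtx.var x a) = Vtx.var x b := by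
  choose σ hlow hhigh using exists_map_gadget hn α
  have hsucc : ∀ k (hk : k + 1 < n - 1),
      (σ ⟨k + 1, hk⟩ : ℕ) = σ ⟨k, by omega⟩ + 1 := by
    intro k hk
    obtain ⟨b, hb⟩ := hlow ⟨k + 1, hk⟩ 0
    obtain ⟨c, hc⟩ := hhigh ⟨k, by omega⟩ 0
    exact congrArg Fin.val (Vtx.var.inj (hb.symm.trans hc)).1
  have hadd : ∀ k (hk : k < n - 1), (σ ⟨k, hk⟩ : ℕ) = σ ⟨0, by omega⟩ + k := by
    intro k
    induction k with
    | zero => simp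
    | succ k ih =>
      intro hk
      rw [hsucc k hk, ih]
      rfl
  have hσ : ∀ i, σ i = i := by
    intro i
    have hlast := hadd (n - 2) (by omega)
    have hlt := (σ ⟨n - 2, by omega⟩).2
    have hi := hadd i i.2
    exact Fin.ext (by simp only [Fin.eta] at hi; omega)
  obtain ⟨i, rfl | rfl⟩ := exists_eq_low_or_eq_high hn x
  · simpa [hσ] using hlow i a
  · simpa [hσ] using hhigh i a

end HomXor

open HomXor in
/-- If `n ≥ 2` and every variable occurs in at least one clause of `φ`, then
every automorphism of `G_φ` maps each set `{X^0, X^1}` to itself: it either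
fixes both `X^0` and `X^1` or interchanges them. -/
theorem automorphism_fixes_variable_pairs {n : ℕ} (φ : HomXor n) (hn : 2 ≤ n)
    (hocc : ∀ x : Fin n, φ.OccursIn x) (α : G φ ≃g G φ) :
    ∀ x : Fin n,
      (α (Vtx.var x 0) = Vtx.var x 0 ∧ α (Vtx.var x 1) = Vtx.var x 1) ∨
      (α (Vtx.var x 0) = Vtx.var x 1 ∧ α (Vtx.var x 1) = Vtx.var x 0) := by
  intro x
  obtain ⟨b, hb⟩ := exists_map_var_eq hn α x 0
  obtain ⟨c, hc⟩ := exists_map_var_eq hn α x 1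
  have hbc : b ≠ c := by
    rintro rfl
    have h := α.injective (hb.trans hc.symm)
    simp at h
  simp only [hb, hc, Vtx.var.injEq, true_and]
  clear hb hc
  revert b c
  decide
end

section
/- For every clause C of φ, with variables x < y < z, and every function t : {x,y,z} → 𝔽₂ with t(x) + t(y) + t(z) = 0, there is a unique permutation ρ of the four clause vertices {C_{000}, C_{011}, C_{110}, C_{101}} such that for every clause vertex D of C and every variable vertex v, the vertices D and v are adjacent in G_φ if, and only if, ρ(D) and σ_t(v) are adjacent in G_φ, where σ_t is the permutation of the variable vertices mapping w^b to w^{b + t(w)} for w ∈ {x,y,z} and fixing all other variable vertices. -/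
open SimpleGraph

namespace HomXor

/-- For a clause `c = (x, y, z)` and values `tx, ty, tz ∈ 𝔽₂`, the permutation
`σ_t` of the variable vertices, mapping `w^b` to `w^{b + t(w)}` for
`w ∈ {x, y, z}` and fixing all other variable vertices (extended by the
identity on the remaining vertices of `G_φ`, which are not mentioned in the
statement). -/
def sigmaT {n : ℕ} (φ : HomXor n) (c : Fin n × Fin n × Fin n)
    (tx ty tz : ZMod 2) : Vtx φ → Vtx φ
  | Vtx.var w v =>
      if w = c.1 then Vtx.var w (v + tx)
      else if w = c.2.1 then Vtx.var w (v + ty)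
      else if w = c.2.2 then Vtx.var w (v + tz)
      else Vtx.var w v
  | u => u

/-- A clause vertex is adjacent to exactly one of the two vertices of each of its variables. -/
theorem adj_cl_var_iff {n : ℕ} (φ : HomXor n) (c : {c // c ∈ φ.clauses}) (a b : ZMod 2)
    (x : Fin n) (w : ZMod 2) :
    (G φ).Adj (Vtx.cl c a b) (Vtx.var x w) ↔
      (x = c.1.1 ∧ w = 1 + a) ∨ (x = c.1.2.1 ∧ w = 1 + b) ∨
        (x = c.1.2.2 ∧ w = 1 + a + b) := by
  rw [G, SimpleGraph.fromRel_adj]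
  constructor
  · rintro ⟨-, h | h⟩ <;> cases h <;> simp
  · rintro (⟨rfl, rfl⟩ | ⟨rfl, rfl⟩ | ⟨rfl, rfl⟩)
    · exact ⟨by simp, Or.inl (Edge.cx c a b)⟩
    · exact ⟨by simp, Or.inl (Edge.cy c a b)⟩
    · exact ⟨by simp, Or.inl (Edge.cz c a b)⟩

/-- For every clause `C` of `φ`, with variables `x < y < z`, and every
`t : {x, y, z} → 𝔽₂` with `t(x) + t(y) + t(z) = 0`, there is a unique
permutation `ρ` of the four clause vertices of `C` (indexed by the pairs
`(a, b) ∈ 𝔽₂ × 𝔽₂`, the pair `(a, b)` standing for `C_{a b (a+b)}`) such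
that for every clause vertex `D` of `C` and every variable vertex `v`,
`D` and `v` are adjacent in `G_φ` iff `ρ(D)` and `σ_t(v)` are adjacent. -/
theorem exists_unique_clause_permutation {n : ℕ} (φ : HomXor n)
    (c : Fin n × Fin n × Fin n) (hc : c ∈ φ.clauses)
    (tx ty tz : ZMod 2) (ht : tx + ty + tz = 0) :
    ∃! ρ : Equiv.Perm (ZMod 2 × ZMod 2),
      ∀ (a b : ZMod 2) (x : Fin n) (w : ZMod 2),
        (G φ).Adj (Vtx.cl ⟨c, hc⟩ a b) (Vtx.var x w) ↔
          (G φ).Adj (Vtx.cl ⟨c, hc⟩ (ρ (a, b)).1 (ρ (a, b)).2)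
            (sigmaT φ c tx ty tz (Vtx.var x w)) := by
  obtain ⟨hxy, hyz⟩ := φ.ordered c hc
  have hxz := hxy.trans hyz
  refine ⟨Equiv.addRight (tx, ty), ?_, ?_⟩
  · intro a b x w
    obtain rfl : tz = tx + ty := by
      revert tx ty tz
      decide
    by_cases hx : x = c.1
    · subst hx
      simp [sigmaT, adj_cl_var_iff, hxy.ne, hxz.ne, ← add_assoc]
    by_cases hy : x = c.2.1
    · subst hy
      simp [sigmaT, adj_cl_var_iff, hxy.ne', hyz.ne, ← add_assoc]
    by_cases hz : x = c.2.2
    · subst hz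
      simp only [sigmaT, adj_cl_var_iff, hx, hy, Equiv.coe_addRight, Prod.mk_add_mk,
        if_true, if_false, false_and, true_and, false_or]
      rw [show 1 + (a + tx) + (b + ty) = 1 + a + b + (tx + ty) by ring, add_left_inj]
    · simp [sigmaT, adj_cl_var_iff, hx, hy, hz]
  · intro ρ hρ
    ext ⟨a, b⟩ : 1
    have h₁ := hρ a b c.1 (1 + a)
    have h₂ := hρ a b c.2.1 (1 + b)
    simp [sigmaT, adj_cl_var_iff, hxy.ne, hxz.ne, add_assoc] at h₁
    simp [sigmaT, adj_cl_var_iff, hxy.ne', hyz.ne, add_assoc] at h₂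
    exact Prod.ext h₁.symm h₂.symm

end HomXor
end

section
/- If T is a satisfying assignment of the homogeneous 3-XOR formula φ, then the map α_T is an automorphism of the graph G_φ. -/
open SimpleGraph

namespace HomXor

/-- For an assignment `T`, the map `α_T` on the vertices of `G_φ`: each
variable vertex `X^b` is mapped to `X^{b + T(X)}`; each clause vertex
`C_{a b (a+b)}` (for a clause with variables `x < y < z`) is mapped to
`C_{a + T(x), b + T(y), (a+b) + T(z)}` — in our indexing by the first two
subscripts, to `cl c (a + T x) (b + T y)`, which is the same vertex since
`T(x) + T(y) + T(z) = 0` for a satisfying assignment; and every vertex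
`i_l`, `i_r`, `i_s` is fixed. -/
def alphaMap {n : ℕ} (φ : HomXor n) (T : Fin n → ZMod 2) : Vtx φ → Vtx φ
  | Vtx.cl c a b => Vtx.cl c (a + T c.1.1) (b + T c.1.2.1)
  | Vtx.var x v => Vtx.var x (v + T x)
  | u => u

end HomXor

namespace HomXor

theorem alphaMap_involutive {n : ℕ} (φ : HomXor n) (T : Fin n → ZMod 2) :
    Function.Involutive (alphaMap φ T) := by
  intro u
  cases u <;> simp [alphaMap, add_assoc, CharTwo.add_self_eq_zero]

theorem Satisfies.eq_add {n : ℕ} {φ : HomXor n} {T : Fin n → ZMod 2} (hT : φ.Satisfies T)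
    (c : {c // c ∈ φ.clauses}) : T c.1.2.2 = T c.1.1 + T c.1.2.1 :=
  (CharTwo.add_eq_zero.mp (hT c.1 c.2)).symm

/-- `α_T` maps edges to edges, possibly reversing the orientation chosen in `Edge`. -/
theorem Edge.alphaMap {n : ℕ} {φ : HomXor n} {T : Fin n → ZMod 2} (hT : φ.Satisfies T)
    {u v : Vtx φ} (h : Edge φ u v) :
    Edge φ (alphaMap φ T u) (alphaMap φ T v) ∨ Edge φ (alphaMap φ T v) (alphaMap φ T u) := by
  cases h with
  | cx c a b =>
    left
    simpa [HomXor.alphaMap, add_assoc] using Edge.cx c (a + T c.1.1) (b + T c.1.2.1)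
  | cy c a b =>
    left
    simpa [HomXor.alphaMap, add_assoc] using Edge.cy c (a + T c.1.1) (b + T c.1.2.1)
  | cz c a b =>
    left
    have key : 1 + a + b + T c.1.2.2 = 1 + (a + T c.1.1) + (b + T c.1.2.1) := by
      rw [hT.eq_add]
      ring
    simpa only [HomXor.alphaMap, key] using Edge.cz c (a + T c.1.1) (b + T c.1.2.1)
  | xx x =>
    have hx : ∀ t : ZMod 2, t = 0 ∨ t = 1 := by decide
    rcases hx (T x) with h | h
    · left
      simpa [HomXor.alphaMap, h] using Edge.xx x
    · right
      simpa [HomXor.alphaMap, h, CharTwo.add_self_eq_zero] using Edge.xx x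
  | lr i => exact .inl (Edge.lr i)
  | rs i => exact .inl (Edge.rs i)
  | lv i v => exact .inl (Edge.lv i _)
  | rv i v => exact .inl (Edge.rv i _)

theorem Satisfies.adj_alphaMap {n : ℕ} {φ : HomXor n} {T : Fin n → ZMod 2} (hT : φ.Satisfies T)
    {u v : Vtx φ} (h : (G φ).Adj u v) : (G φ).Adj (alphaMap φ T u) (alphaMap φ T v) := by
  rw [G, SimpleGraph.fromRel_adj] at h ⊢
  refine ⟨(alphaMap_involutive φ T).injective.ne h.1, ?_⟩
  rcases h.2 with h | h
  · exact h.alphaMap hT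
  · exact (h.alphaMap hT).symm

end HomXor

open HomXor in
/-- If `T` is a satisfying assignment of the homogeneous 3-XOR formula `φ`,
then the map `α_T` is an automorphism of the graph `G_φ`. -/
theorem alphaMap_is_automorphism {n : ℕ} (φ : HomXor n) (T : Fin n → ZMod 2)
    (hT : φ.Satisfies T) :
    ∃ α : G φ ≃g G φ, ⇑α = alphaMap φ T := by
  have hinv := alphaMap_involutive φ T
  refine ⟨⟨hinv.toPerm, fun {u v} => ⟨fun h => ?_, hT.adj_alphaMap⟩⟩, rfl⟩
  simpa [hinv u, hinv v] using hT.adj_alphaMap h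
end

section
/- Suppose n ≥ 2 and every variable occurs in at least one clause of the homogeneous 3-XOR formula φ. Then φ is uniquely satisfiable if, and only if, the graph G_φ is asymmetric. -/
open SimpleGraph

namespace HomXor

variable {n : ℕ} {φ : HomXor n}

lemma adj_st_iff {i : Fin (n - 1)} {w : Vtx φ} : (G φ).Adj (.st i) w ↔ w = .rt i := by
  rw [G, SimpleGraph.fromRel_adj]
  constructor
  · rintro ⟨-, h | h⟩ <;> cases h
    rfl
  · rintro rfl
    exact ⟨by simp, .inr (.rs i)⟩

lemma adj_rt_iff {i : Fin (n - 1)} {w : Vtx φ} :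
    (G φ).Adj (.rt i) w ↔ w = .lt i ∨ w = .st i ∨ ∃ v, w = .var (high i) v := by
  rw [G, SimpleGraph.fromRel_adj]
  constructor
  · rintro ⟨-, h | h⟩ <;> cases h <;> simp
  · rintro (rfl | rfl | ⟨v, rfl⟩)
    · exact ⟨by simp, .inr (.lr i)⟩
    · exact ⟨by simp, .inl (.rs i)⟩
    · exact ⟨by simp, .inl (.rv i v)⟩

lemma adj_lt_iff {i : Fin (n - 1)} {w : Vtx φ} :
    (G φ).Adj (.lt i) w ↔ w = .rt i ∨ ∃ v, w = .var (low i) v := by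
  rw [G, SimpleGraph.fromRel_adj]
  constructor
  · rintro ⟨-, h | h⟩ <;> cases h <;> simp
  · rintro (rfl | ⟨v, rfl⟩)
    · exact ⟨by simp, .inl (.lr i)⟩
    · exact ⟨by simp, .inl (.lv i v)⟩

lemma adj_cl_iff {c : {c // c ∈ φ.clauses}} {a b : ZMod 2} {w : Vtx φ} :
    (G φ).Adj (.cl c a b) w ↔
      w = .var c.1.1 (1 + a) ∨ w = .var c.1.2.1 (1 + b) ∨ w = .var c.1.2.2 (1 + a + b) := by
  rw [G, SimpleGraph.fromRel_adj]
  constructor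
  · rintro ⟨-, h | h⟩ <;> cases h <;> simp
  · rintro (rfl | rfl | rfl)
    · exact ⟨by simp, .inl (.cx c a b)⟩
    · exact ⟨by simp, .inl (.cy c a b)⟩
    · exact ⟨by simp, .inl (.cz c a b)⟩

lemma adj_var_var_iff {x y : Fin n} {v w : ZMod 2} :
    (G φ).Adj (.var x v) (.var y w) ↔ x = y ∧ v ≠ w := by
  rw [G, SimpleGraph.fromRel_adj]
  constructor
  · rintro ⟨-, h | h⟩ <;> cases h <;> simp
  · rintro ⟨rfl, h⟩
    refine ⟨by simpa using h, ?_⟩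
    obtain ⟨rfl, rfl⟩ | ⟨rfl, rfl⟩ : v = 0 ∧ w = 1 ∨ v = 1 ∧ w = 0 := by
      revert v w; decide
    · exact .inl (.xx x)
    · exact .inr (.xx x)

lemma exists_eq_st_of_subsingleton_neighbors (hn : 2 ≤ n) {v : Vtx φ}
    (hv : ∀ u w, (G φ).Adj v u → (G φ).Adj v w → u = w) : ∃ i, v = .st i := by
  cases v with
  | st i => exact ⟨i, rfl⟩
  | rt i => simpa using hv (.lt i) (.st i) (by simp [adj_rt_iff]) (by simp [adj_rt_iff])
  | lt i => simpa using hv (.rt i) (.var (low i) 0) (by simp [adj_lt_iff]) (by simp [adj_lt_iff])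
  | cl c a b =>
    have h := hv (.var c.1.1 (1 + a)) (.var c.1.2.1 (1 + b)) (by simp [adj_cl_iff])
      (by simp [adj_cl_iff])
    simp only [Vtx.var.injEq] at h
    exact absurd h.1 (φ.ordered c.1 c.2).1.ne
  | var x v =>
    obtain ⟨i, rfl | rfl⟩ := exists_eq_low_or_eq_high hn x
    · simpa using hv (.var (low i) (v + 1)) (.lt i) (by simp [adj_var_var_iff])
        (by simp [SimpleGraph.adj_comm, adj_lt_iff])
    · simpa using hv (.var (high i) (v + 1)) (.rt i) (by simp [adj_var_var_iff])
        (by simp [SimpleGraph.adj_comm, adj_rt_iff])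

section Automorphism

variable (α : G φ ≃g G φ)

/-- Every automorphism of `G φ` permutes the gadgets `{i_l, i_r, i_s}`. -/
lemma exists_gadget_map (hn : 2 ≤ n) : ∃ σ : Fin (n - 1) → Fin (n - 1),
    ∀ i, α (.st i) = .st (σ i) ∧ α (.rt i) = .rt (σ i) ∧ α (.lt i) = .lt (σ i) := by
  have hst : ∀ i, ∃ j, α (.st i) = .st j := fun i => by
    refine exists_eq_st_of_subsingleton_neighbors hn fun u w hu hw => ?_
    obtain ⟨u, rfl⟩ := α.surjective u
    obtain ⟨w, rfl⟩ := α.surjective w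
    rw [α.map_adj_iff, adj_st_iff] at hu hw
    rw [hu, hw]
  choose σ hσ using hst
  refine ⟨σ, fun i => ?_⟩
  have hrt : α (.rt i) = .rt (σ i) := by
    rw [← adj_st_iff, ← hσ, α.map_adj_iff, adj_st_iff]
  refine ⟨hσ i, hrt, ?_⟩
  have h : (G φ).Adj (α (.rt i)) (α (.lt i)) := by simp [α.map_adj_iff, adj_rt_iff]
  rw [hrt, adj_rt_iff] at h
  obtain h | h | ⟨v, h⟩ := h
  · exact h
  · rw [← hσ, α.injective.eq_iff] at h
    cases h
  · obtain ⟨u, hu⟩ := α.surjective (.var (high (σ i)) (v + 1))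
    have hl : (G φ).Adj (α (.lt i)) (α u) := by simp [h, hu, adj_var_var_iff]
    have hr : (G φ).Adj (α (.rt i)) (α u) := by simp [hrt, hu, adj_rt_iff]
    rw [α.map_adj_iff, adj_lt_iff] at hl
    rw [α.map_adj_iff, adj_rt_iff] at hr
    obtain rfl | ⟨w, rfl⟩ := hl
    · simp at hr
    · simp [low, high] at hr

lemma exists_map_var_low {i j : Fin (n - 1)} (hr : α (.rt i) = .rt j) (hl : α (.lt i) = .lt j)
    (v : ZMod 2) : ∃ w, α (.var (low i) v) = .var (low j) w := by
  have h : (G φ).Adj (α (.lt i)) (α (.var (low i) v)) := by simp [α.map_adj_iff, adj_lt_iff]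
  rw [hl, adj_lt_iff, ← hr, α.injective.eq_iff] at h
  simpa using h

lemma exists_map_var_high {i j : Fin (n - 1)} (hs : α (.st i) = .st j) (hr : α (.rt i) = .rt j)
    (hl : α (.lt i) = .lt j) (v : ZMod 2) : ∃ w, α (.var (high i) v) = .var (high j) w := by
  have h : (G φ).Adj (α (.rt i)) (α (.var (high i) v)) := by simp [α.map_adj_iff, adj_rt_iff]
  rw [hr, adj_rt_iff, ← hs, ← hl, α.injective.eq_iff, α.injective.eq_iff] at h
  simpa using h

/-- Every automorphism of `G φ` fixes all the gadget vertices. -/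
lemma map_gadget (hn : 2 ≤ n) (i : Fin (n - 1)) :
    α (.st i) = .st i ∧ α (.rt i) = .rt i ∧ α (.lt i) = .lt i := by
  obtain ⟨σ, hσ⟩ := exists_gadget_map α hn
  have hsucc : ∀ i j : Fin (n - 1), j.1 = i.1 + 1 → (σ j).1 = (σ i).1 + 1 := fun i j hij => by
    obtain ⟨v, hv⟩ := exists_map_var_low α (hσ j).2.1 (hσ j).2.2 0
    obtain ⟨w, hw⟩ := exists_map_var_high α (hσ i).1 (hσ i).2.1 (hσ i).2.2 0
    have hlh : low j = high i := Fin.ext hij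
    rw [hlh, hw] at hv
    simp only [Vtx.var.injEq, low, high, Fin.mk.injEq] at hv
    exact hv.1.symm
  have hadd : ∀ (k : ℕ) (hk : k < n - 1), (σ ⟨k, hk⟩).1 = (σ ⟨0, by omega⟩).1 + k := by
    intro k
    induction k with
    | zero => simp
    | succ k ih =>
      intro hk
      rw [hsucc ⟨k, by omega⟩ ⟨k + 1, hk⟩ rfl, ih, add_assoc]
  have hi : σ i = i := by
    apply Fin.ext
    have hlast := hadd (n - 2) (by omega)
    have hbound := (σ ⟨n - 2, by omega⟩).2
    have := hadd i.1 i.2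
    simp only [Fin.eta] at this
    omega
  simpa [hi] using hσ i

lemma exists_map_var (hn : 2 ≤ n) (x : Fin n) (v : ZMod 2) : ∃ w, α (.var x v) = .var x w := by
  obtain ⟨i, rfl | rfl⟩ := exists_eq_low_or_eq_high hn x
  · exact exists_map_var_low α (map_gadget α hn i).2.1 (map_gadget α hn i).2.2 v
  · exact exists_map_var_high α (map_gadget α hn i).1 (map_gadget α hn i).2.1
      (map_gadget α hn i).2.2 v

/-- Every automorphism of `G φ` acts on the variable vertices by adding an assignment. -/
lemma exists_assignment_map_var (hn : 2 ≤ n) :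
    ∃ T : Fin n → ZMod 2, ∀ x v, α (.var x v) = .var x (v + T x) := by
  choose f hf using exists_map_var α hn
  refine ⟨fun x => f x 0, fun x v => ?_⟩
  have h : (G φ).Adj (α (.var x 0)) (α (.var x 1)) := by simp [α.map_adj_iff, adj_var_var_iff]
  rw [hf, hf, adj_var_var_iff] at h
  rw [hf]
  congr 1
  have key : ∀ s t : ZMod 2, s ≠ t → t = 1 + s := by decide
  obtain rfl | rfl : v = 0 ∨ v = 1 := by revert v; decide
  · simp
  · exact key _ _ h.2

lemma exists_map_cl (hn : 2 ≤ n) (c : {c // c ∈ φ.clauses}) (a b : ZMod 2) :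
    ∃ c' a' b', α (.cl c a b) = .cl c' a' b' := by
  cases h : α (.cl c a b) with
  | cl c' a' b' => exact ⟨c', a', b', rfl⟩
  | var x v =>
    obtain ⟨w, hw⟩ := exists_map_var α.symm hn x v
    rw [← h, RelIso.symm_apply_apply] at hw
    cases hw
  | lt i => rw [← (map_gadget α hn i).2.2, α.injective.eq_iff] at h; cases h
  | rt i => rw [← (map_gadget α hn i).2.1, α.injective.eq_iff] at h; cases h
  | st i => rw [← (map_gadget α hn i).1, α.injective.eq_iff] at h; cases h

lemma map_cl_of_map_var (hn : 2 ≤ n) {T : Fin n → ZMod 2}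
    (hT : ∀ x v, α (.var x v) = .var x (v + T x)) (c : {c // c ∈ φ.clauses}) (a b : ZMod 2) :
    α (.cl c a b) = .cl c (a + T c.1.1) (b + T c.1.2.1) ∧
      T c.1.1 + T c.1.2.1 + T c.1.2.2 = 0 := by
  obtain ⟨c', a', b', h⟩ := exists_map_cl α hn c a b
  have hx : (G φ).Adj (α (.cl c a b)) (α (.var c.1.1 (1 + a))) := by
    simp [α.map_adj_iff, adj_cl_iff]
  have hy : (G φ).Adj (α (.cl c a b)) (α (.var c.1.2.1 (1 + b))) := by
    simp [α.map_adj_iff, adj_cl_iff]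
  have hz : (G φ).Adj (α (.cl c a b)) (α (.var c.1.2.2 (1 + a + b))) := by
    simp [α.map_adj_iff, adj_cl_iff]
  rw [h, hT, adj_cl_iff] at hx hy hz
  simp only [Vtx.var.injEq] at hx hy hz
  have hc := φ.ordered c.1 c.2
  have hc' := φ.ordered c'.1 c'.2
  have h1 : c.1.1 = c'.1.1 := by grind
  have h2 : c.1.2.1 = c'.1.2.1 := by grind
  have h3 : c.1.2.2 = c'.1.2.2 := by grind
  obtain rfl : c = c' := Subtype.ext (Prod.ext h1 (Prod.ext h2 h3))
  have hx' : 1 + a + T c.1.1 = 1 + a' := by grind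
  have hy' : 1 + b + T c.1.2.1 = 1 + b' := by grind
  have hz' : 1 + a + b + T c.1.2.2 = 1 + a' + b' := by grind
  obtain rfl : a' = a + T c.1.1 := by linear_combination -hx'
  obtain rfl : b' = b + T c.1.2.1 := by linear_combination -hy'
  refine ⟨h, ?_⟩
  have key : ∀ s t u : ZMod 2, u = s + t → s + t + u = 0 := by decide
  exact key _ _ _ (by linear_combination hz')

end Automorphism

/-- Translation of the vertices of `G φ` by an assignment. -/
def shift (T : Fin n → ZMod 2) : Vtx φ → Vtx φ
  | .cl c a b => .cl c (a + T c.1.1) (b + T c.1.2.1)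
  | .var x v => .var x (v + T x)
  | .lt i => .lt i
  | .rt i => .rt i
  | .st i => .st i

lemma shift_involutive (T : Fin n → ZMod 2) : Function.Involutive (shift (φ := φ) T) := by
  intro v
  cases v <;> simp [shift, add_assoc, CharTwo.add_self_eq_zero]

lemma Satisfies.adj_shift {T : Fin n → ZMod 2} (hT : φ.Satisfies T) {u v : Vtx φ}
    (h : (G φ).Adj u v) : (G φ).Adj (shift T u) (shift T v) := by
  have edge : ∀ {u v : Vtx φ}, Edge φ u v → (G φ).Adj (shift T u) (shift T v) := by
    intro u v h
    cases h with
    | cx c a b => simp [shift, adj_cl_iff, add_assoc]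
    | cy c a b => simp [shift, adj_cl_iff, add_assoc]
    | cz c a b =>
      refine adj_cl_iff.2 (.inr (.inr ?_))
      have key : ∀ s t u : ZMod 2, s + t + u = 0 → u = s + t := by decide
      simp only [shift, key _ _ _ (hT c.1 c.2)]
      congr 1
      ring
    | xx x => simp [shift, adj_var_var_iff]
    | lr i => simp [shift, adj_lt_iff]
    | rs i => simp [shift, adj_rt_iff]
    | lv i v => simp [shift, adj_lt_iff]
    | rv i v => simp [shift, adj_rt_iff]
  rw [G, SimpleGraph.fromRel_adj] at h
  exact h.2.elim edge fun h => (edge h).symm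

/-- Translation by a satisfying assignment, as an automorphism of `G φ`. -/
def Satisfies.shiftIso {T : Fin n → ZMod 2} (hT : φ.Satisfies T) : G φ ≃g G φ where
  toEquiv := (shift_involutive T).toPerm
  map_rel_iff' {u v} := by
    refine ⟨fun h => ?_, hT.adj_shift⟩
    simpa [shift_involutive T u, shift_involutive T v] using hT.adj_shift h

end HomXor

open HomXor in
/-- If `n ≥ 2` and every variable occurs in at least one clause of the
homogeneous 3-XOR formula `φ`, then `φ` is uniquely satisfiable (the all-zero
assignment is its only satisfying assignment) if, and only if, `G_φ` is
asymmetric (its only automorphism is the identity). -/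
theorem uniquely_satisfiable_iff_asymmetric {n : ℕ} (φ : HomXor n)
    (hn : 2 ≤ n) (hocc : ∀ x : Fin n, φ.OccursIn x) :
    (∀ T : Fin n → ZMod 2, φ.Satisfies T → T = fun _ => 0) ↔
      (∀ α : G φ ≃g G φ, ∀ v : Vtx φ, α v = v) := by
  constructor
  · intro huniq α
    obtain ⟨T, hT⟩ := exists_assignment_map_var α hn
    have hcl := map_cl_of_map_var α hn hT
    obtain rfl := huniq T fun c hc => (hcl ⟨c, hc⟩ 0 0).2
    rintro (⟨c, a, b⟩ | ⟨x, v⟩ | i | i | i)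
    · simpa using (hcl c a b).1
    · simpa using hT x v
    · exact (map_gadget α hn i).2.2
    · exact (map_gadget α hn i).2.1
    · exact (map_gadget α hn i).1
  · intro hasym T hT
    funext x
    have h : (Vtx.var x (0 + T x) : Vtx φ) = Vtx.var x 0 := hasym hT.shiftIso (Vtx.var x 0)
    simpa using h
end

section
/- If the bipartite incidence graph Φ of the homogeneous 3-XOR formula φ is asymmetric, then every automorphism of the graph G^1_φ equals α_T for some satisfying assignment T of φ. -/
open SimpleGraph

namespace HomXor

variable {n : ℕ}

/-- The vertices of the graph `G¹_φ`:
* `cl c a b` is the clause vertex `C_{a b (a+b)}` — note that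
  `{C_{000}, C_{011}, C_{110}, C_{101}}` is exactly the set of `C_{a b c}`
  with `a + b + c = 0` in `𝔽₂`, so the four clause vertices of `C` are
  `cl c a b` for `(a, b) ∈ 𝔽₂ × 𝔽₂`;
* `var x v` is the variable vertex `X_x^v`. -/
inductive Vtx1 (φ : HomXor n) : Type
  | cl (c : {c // c ∈ φ.clauses}) (a b : ZMod 2)
  | var (x : Fin n) (v : ZMod 2)
  deriving DecidableEq

/-- The edges of the graph `G¹_φ`.  For a clause `C` with variables
`x < y < z`, the clause vertex `C_{a b (a+b)}` is adjacent to `x^{1+a}`,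
`y^{1+b}` and `z^{1+a+b}` (this is exactly: `C_{000}` adjacent to
`x^1, y^1, z^1`; `C_{011}` to `x^1, y^0, z^0`; `C_{110}` to `x^0, y^0, z^1`;
`C_{101}` to `x^0, y^1, z^0`).  For each variable `X` there is an edge
between `X^0` and `X^1`. -/
inductive Edge1 (φ : HomXor n) : Vtx1 φ → Vtx1 φ → Prop
  | cx (c : {c // c ∈ φ.clauses}) (a b : ZMod 2) :
      Edge1 φ (Vtx1.cl c a b) (Vtx1.var c.1.1 (1 + a))
  | cy (c : {c // c ∈ φ.clauses}) (a b : ZMod 2) :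
      Edge1 φ (Vtx1.cl c a b) (Vtx1.var c.1.2.1 (1 + b))
  | cz (c : {c // c ∈ φ.clauses}) (a b : ZMod 2) :
      Edge1 φ (Vtx1.cl c a b) (Vtx1.var c.1.2.2 (1 + a + b))
  | xx (x : Fin n) : Edge1 φ (Vtx1.var x 0) (Vtx1.var x 1)

/-- The graph `G¹_φ`. -/
def G1 (φ : HomXor n) : SimpleGraph (Vtx1 φ) := SimpleGraph.fromRel (Edge1 φ)

/-- The incidence relation between clauses and variables of `φ`. -/
def IncRel (φ : HomXor n) :
    ({c // c ∈ φ.clauses} ⊕ Fin n) → ({c // c ∈ φ.clauses} ⊕ Fin n) → Prop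
  | Sum.inl c, Sum.inr x => x = c.1.1 ∨ x = c.1.2.1 ∨ x = c.1.2.2
  | _, _ => False

/-- The bipartite incidence graph `Φ` of `φ`: its vertices are the clauses
and the variables, with an edge between a clause `C` and a variable `X` iff
`X` occurs in `C`. -/
def Inc (φ : HomXor n) : SimpleGraph ({c // c ∈ φ.clauses} ⊕ Fin n) :=
  SimpleGraph.fromRel (IncRel φ)

/-- For an assignment `T`, the map `α_T` on the vertices of `G¹_φ`: each
variable vertex `X^b` is mapped to `X^{b + T(X)}`, and each clause vertex
`C_{a b (a+b)}` (for a clause with variables `x < y < z`) is mapped to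
`C_{a + T(x), b + T(y), (a+b) + T(z)}` — in our indexing by the first two
subscripts, to `cl c (a + T x) (b + T y)`, which is the same vertex since
`T(x) + T(y) + T(z) = 0` for a satisfying assignment. -/
def alphaMap1 {n : ℕ} (φ : HomXor n) (T : Fin n → ZMod 2) : Vtx1 φ → Vtx1 φ
  | Vtx1.cl c a b => Vtx1.cl c (a + T c.1.1) (b + T c.1.2.1)
  | Vtx1.var x v => Vtx1.var x (v + T x)

end HomXor

namespace HomXor

variable {n : ℕ} {φ : HomXor n}

/-- The variables occurring in a clause. -/
def clauseVars (c : {c // c ∈ φ.clauses}) : Finset (Fin n) := {c.1.1, c.1.2.1, c.1.2.2}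

lemma mem_clauseVars {c : {c // c ∈ φ.clauses}} {x : Fin n} :
    x ∈ clauseVars c ↔ x = c.1.1 ∨ x = c.1.2.1 ∨ x = c.1.2.2 := by
  simp [clauseVars]

lemma card_clauseVars (c : {c // c ∈ φ.clauses}) : (clauseVars c).card = 3 := by
  obtain ⟨h₁, h₂⟩ := φ.ordered c.1 c.2
  exact Finset.card_eq_three.2 ⟨_, _, _, h₁.ne, (h₁.trans h₂).ne, h₂.ne, rfl⟩

lemma clauseVars_injective :
    Function.Injective (clauseVars : {c // c ∈ φ.clauses} → Finset (Fin n)) := by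
  rintro ⟨⟨x, y, z⟩, hc⟩ ⟨⟨x', y', z'⟩, hd⟩ h
  have hx := congrArg (x ∈ ·) h
  have hy := congrArg (y ∈ ·) h
  have hz := congrArg (z ∈ ·) h
  have hx' := congrArg (x' ∈ ·) h
  have hy' := congrArg (y' ∈ ·) h
  have hz' := congrArg (z' ∈ ·) h
  have h₁ := φ.ordered _ hc
  have h₂ := φ.ordered _ hd
  simp only [mem_clauseVars, eq_iff_iff, true_or, or_true, true_iff, iff_true] at *
  simp only [Subtype.mk.injEq, Prod.mk.injEq]
  omega

lemma eq_or_eq_one_add (v w : ZMod 2) : w = v ∨ w = 1 + v := by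
  revert v w; decide

lemma G1_adj_cl_var {c : {c // c ∈ φ.clauses}} {a b : ZMod 2} {x : Fin n} {v : ZMod 2} :
    (G1 φ).Adj (.cl c a b) (.var x v) ↔
      (x = c.1.1 ∧ v = 1 + a) ∨ (x = c.1.2.1 ∧ v = 1 + b) ∨ (x = c.1.2.2 ∧ v = 1 + a + b) := by
  rw [G1, SimpleGraph.fromRel_adj]
  constructor
  · rintro ⟨-, h | h⟩ <;> cases h <;> simp
  · rintro (⟨rfl, rfl⟩ | ⟨rfl, rfl⟩ | ⟨rfl, rfl⟩)
    · exact ⟨by simp, .inl (.cx ..)⟩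
    · exact ⟨by simp, .inl (.cy ..)⟩
    · exact ⟨by simp, .inl (.cz ..)⟩

lemma not_G1_adj_cl_cl {c d : {c // c ∈ φ.clauses}} {a b a' b' : ZMod 2} :
    ¬ (G1 φ).Adj (.cl c a b) (.cl d a' b') := by
  rw [G1, SimpleGraph.fromRel_adj]
  rintro ⟨-, h | h⟩ <;> cases h

lemma G1_adj_var_var {x y : Fin n} {v w : ZMod 2} :
    (G1 φ).Adj (.var x v) (.var y w) ↔ y = x ∧ w = 1 + v := by
  rw [G1, SimpleGraph.fromRel_adj]
  constructor
  · rintro ⟨-, h | h⟩ <;> cases h <;> exact ⟨rfl, by decide⟩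
  · rintro ⟨rfl, rfl⟩
    refine ⟨by simp, ?_⟩
    obtain rfl | rfl := eq_or_eq_one_add 0 v
    · exact .inl (.xx _)
    · exact .inr (.xx _)

lemma mem_clauseVars_iff_exists_adj {c : {c // c ∈ φ.clauses}} (a b : ZMod 2) {x : Fin n} :
    x ∈ clauseVars c ↔ ∃ v, (G1 φ).Adj (.cl c a b) (.var x v) := by
  simp [mem_clauseVars, G1_adj_cl_var, exists_or]

lemma Inc_adj_inl_inr {c : {c // c ∈ φ.clauses}} {x : Fin n} :
    (Inc φ).Adj (.inl c) (.inr x) ↔ x ∈ clauseVars c := by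
  simp [Inc, SimpleGraph.fromRel_adj, IncRel, mem_clauseVars]

/-- Permutations of the clauses and of the variables that preserve occurrence
induce an automorphism of the incidence graph. -/
def incIso (δ : Equiv.Perm {c // c ∈ φ.clauses}) (π : Equiv.Perm (Fin n))
    (h : ∀ c x, π x ∈ clauseVars (δ c) ↔ x ∈ clauseVars c) : Inc φ ≃g Inc φ where
  toEquiv := Equiv.sumCongr δ π
  map_rel_iff' := by
    rintro (c | x) (d | y)
    · simp [Inc, SimpleGraph.fromRel_adj, IncRel]
    · simpa [Inc_adj_inl_inr] using h c y
    · simpa [(Inc φ).adj_comm (.inr _), Inc_adj_inl_inr] using h d x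
    · simp [Inc, SimpleGraph.fromRel_adj, IncRel]

/-- In an asymmetric formula, distinct variables occur in different clauses. -/
lemma eq_of_forall_mem_clauseVars_iff (hasym : ∀ β : Inc φ ≃g Inc φ, ∀ v, β v = v) {x y : Fin n}
    (h : ∀ c : {c // c ∈ φ.clauses}, x ∈ clauseVars c ↔ y ∈ clauseVars c) : x = y := by
  have key : ∀ (c : {c // c ∈ φ.clauses}) u,
      Equiv.swap x y u ∈ clauseVars ((Equiv.refl _) c) ↔ u ∈ clauseVars c := by
    intro c u
    rw [Equiv.swap_apply_def]
    split_ifs with h₁ h₂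
    · subst h₁; exact (h c).symm
    · subst h₂; exact h c
    · rfl
  have := hasym (incIso (Equiv.refl _) (Equiv.swap x y) key) (.inr x)
  simpa [incIso, eq_comm] using this

lemma ncard_neighborSet_cl (c : {c // c ∈ φ.clauses}) (a b : ZMod 2) :
    ((G1 φ).neighborSet (.cl c a b)).ncard = 3 := by
  obtain ⟨h₁, h₂⟩ := φ.ordered c.1 c.2
  refine Set.ncard_eq_three.2 ⟨.var c.1.1 (1 + a), .var c.1.2.1 (1 + b),
    .var c.1.2.2 (1 + a + b), by simp [h₁.ne], by simp [(h₁.trans h₂).ne], by simp [h₂.ne], ?_⟩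
  ext (⟨d, a', b'⟩ | ⟨x, v⟩)
  · simp [not_G1_adj_cl_cl]
  · simp [G1_adj_cl_var]

/-- The two vertices of a clause `c ∋ X_x` adjacent to `X_x^v`, indexed by a bit. -/
def clauseNeighbor (x : Fin n) (v : ZMod 2) (p : {c // c ∈ φ.clauses} × ZMod 2) : Vtx1 φ :=
  if x = p.1.1.1 then .cl p.1 (1 + v) p.2
  else if x = p.1.1.2.1 then .cl p.1 p.2 (1 + v)
  else .cl p.1 p.2 (1 + v + p.2)

lemma clauseNeighbor_injective (x : Fin n) (v : ZMod 2) :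
    Function.Injective (clauseNeighbor (φ := φ) x v) := by
  rintro ⟨c, s⟩ ⟨d, t⟩ h
  unfold clauseNeighbor at h
  dsimp only at h
  split_ifs at h <;> simp_all

lemma adj_cl_iff_clauseNeighbor {x : Fin n} {v : ZMod 2} {c : {c // c ∈ φ.clauses}}
    {a b : ZMod 2} : (G1 φ).Adj (.cl c a b) (.var x v) ↔
      x ∈ clauseVars c ∧ ∃ t, clauseNeighbor x v (c, t) = .cl c a b := by
  obtain ⟨h₁, h₂⟩ := φ.ordered c.1 c.2
  have h₃ := h₁.trans h₂
  have e : ∀ a b v : ZMod 2, (v = 1 + a ↔ 1 + v = a) ∧ (v = 1 + a + b ↔ 1 + v + a = b) := by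
    decide
  rw [G1_adj_cl_var, mem_clauseVars]
  unfold clauseNeighbor
  dsimp only
  split_ifs with hx hy
  · subst hx
    simp [h₁.ne, h₃.ne, (e a b v).1]
  · subst hy
    simp [h₁.ne', h₂.ne, (e b a v).1]
  · simp [hx, hy, (e a b v).2]

lemma ncard_neighborSet_var (x : Fin n) (v : ZMod 2) :
    ((G1 φ).neighborSet (.var x v)).ncard =
      2 * {c : {c // c ∈ φ.clauses} | x ∈ clauseVars c}.ncard + 1 := by
  have hset : (G1 φ).neighborSet (.var x v) = insert (.var x (1 + v))
      (clauseNeighbor x v '' ({c | x ∈ clauseVars c} ×ˢ Set.univ)) := by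
    ext (⟨c, a, b⟩ | ⟨y, w⟩)
    · rw [SimpleGraph.mem_neighborSet, SimpleGraph.adj_comm, adj_cl_iff_clauseNeighbor]
      constructor
      · rintro ⟨h, t, ht⟩
        exact .inr ⟨(c, t), ⟨h, trivial⟩, ht⟩
      · rintro (h | ⟨⟨d, t⟩, ⟨h, -⟩, ht⟩)
        · cases h
        · obtain rfl : d = c := by
            unfold clauseNeighbor at ht
            dsimp only at ht
            split_ifs at ht <;> simp_all
          exact ⟨h, t, ht⟩
    · have : ∀ p, clauseNeighbor (φ := φ) x v p ≠ .var y w := by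
        intro p
        unfold clauseNeighbor
        split_ifs <;> simp
      simp [G1_adj_var_var, this]
  have hnot : .var x (1 + v) ∉
      clauseNeighbor (φ := φ) x v '' ({c | x ∈ clauseVars c} ×ˢ Set.univ) := by
    rintro ⟨p, -, hp⟩
    unfold clauseNeighbor at hp
    split_ifs at hp
  rw [hset, Set.ncard_insert_of_notMem hnot (Set.toFinite _),
    Set.ncard_image_of_injective _ (clauseNeighbor_injective x v), Set.ncard_prod, Set.ncard_univ,
    Nat.card_zmod, mul_comm]

lemma ncard_neighborSet_apply (α : G1 φ ≃g G1 φ) (u : Vtx1 φ) :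
    ((G1 φ).neighborSet (α u)).ncard = ((G1 φ).neighborSet u).ncard :=
  (Nat.card_congr (α.mapNeighborSet u)).symm

/-- Automorphisms map clause vertices to clause vertices: otherwise the neighbours of some clause
vertex would all have degree three, so two variables would occur in no other clause. -/
lemma exists_apply_cl (hasym : ∀ β : Inc φ ≃g Inc φ, ∀ v, β v = v) (α : G1 φ ≃g G1 φ)
    (c : {c // c ∈ φ.clauses}) (a b : ZMod 2) : ∃ d a' b', α (.cl c a b) = .cl d a' b' := by
  rcases hα : α (.cl c a b) with ⟨d, a', b'⟩ | ⟨x, v⟩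
  · exact ⟨d, a', b', rfl⟩
  exfalso
  have hdeg := ncard_neighborSet_apply α (.cl c a b)
  rw [hα, ncard_neighborSet_cl, ncard_neighborSet_var] at hdeg
  have honly : ∀ y ∈ clauseVars c, ∀ d, y ∈ clauseVars d ↔ d = c := by
    intro y hy
    obtain ⟨w, hw⟩ := (mem_clauseVars_iff_exists_adj a b).1 hy
    have hadj := α.map_adj_iff.2 hw
    have hy3 : ((G1 φ).neighborSet (.var y w)).ncard = 3 := by
      rw [← ncard_neighborSet_apply α]
      rw [hα] at hadj
      generalize α (.var y w) = u at hadj ⊢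
      rcases u with ⟨d, a', b'⟩ | ⟨z, u⟩
      · exact ncard_neighborSet_cl ..
      · rw [(G1_adj_var_var.1 hadj).1, ncard_neighborSet_var, hdeg]
    rw [ncard_neighborSet_var] at hy3
    obtain ⟨e, he⟩ := Set.ncard_eq_one.1
      (show {d : {c // c ∈ φ.clauses} | y ∈ clauseVars d}.ncard = 1 by omega)
    have hmem : ∀ d, y ∈ clauseVars d ↔ d = e := fun d => by
      simpa using Set.ext_iff.1 he d
    rwa [(hmem c).1 hy]
  refine (φ.ordered c.1 c.2).1.ne (eq_of_forall_mem_clauseVars_iff hasym fun d => ?_)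
  rw [honly _ (by simp [mem_clauseVars]), honly _ (by simp [mem_clauseVars])]

lemma exists_apply_var (hasym : ∀ β : Inc φ ≃g Inc φ, ∀ v, β v = v) (α : G1 φ ≃g G1 φ)
    (x : Fin n) (v : ZMod 2) : ∃ y w, α (.var x v) = .var y w := by
  rcases hα : α (.var x v) with ⟨d, a, b⟩ | ⟨y, w⟩
  · obtain ⟨e, a', b', h⟩ := exists_apply_cl hasym α.symm d a b
    rw [← hα, RelIso.symm_apply_apply] at h
    cases h
  · exact ⟨y, w, rfl⟩

/-- An automorphism maps each pair `{X^0, X^1}` into such a pair. -/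
lemma exists_variable_map (hasym : ∀ β : Inc φ ≃g Inc φ, ∀ v, β v = v) (α : G1 φ ≃g G1 φ) :
    ∃ π : Fin n → Fin n, ∀ x v, ∃ w, α (.var x v) = .var (π x) w := by
  choose π w h using fun x => exists_apply_var hasym α x 0
  refine ⟨π, fun x v => ?_⟩
  obtain rfl | rfl := eq_or_eq_one_add 0 v
  · exact ⟨_, h x⟩
  · obtain ⟨y, u, hy⟩ := exists_apply_var hasym α x (1 + 0)
    have hadj := α.map_adj_iff.2 (G1_adj_var_var (φ := φ) (x := x) (v := 0).2 ⟨rfl, rfl⟩)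
    rw [h, hy, G1_adj_var_var] at hadj
    exact ⟨u, by rw [hy, hadj.1]⟩

lemma exists_variable_perm (hasym : ∀ β : Inc φ ≃g Inc φ, ∀ v, β v = v) (α : G1 φ ≃g G1 φ) :
    ∃ π : Equiv.Perm (Fin n), ∀ x v, ∃ w, α (.var x v) = .var (π x) w := by
  obtain ⟨π, hπ⟩ := exists_variable_map hasym α
  obtain ⟨σ, hσ⟩ := exists_variable_map hasym α.symm
  have hinv : Function.LeftInverse σ π := fun x => by
    obtain ⟨w, hw⟩ := hπ x 0
    obtain ⟨u, hu⟩ := hσ (π x) w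
    rw [← hw, RelIso.symm_apply_apply] at hu
    exact (Vtx1.var.inj hu).1.symm
  exact ⟨.ofBijective π (Finite.injective_iff_bijective.1 hinv.injective), hπ⟩

lemma clauseVars_eq_map {α : G1 φ ≃g G1 φ} {π : Equiv.Perm (Fin n)}
    (hπ : ∀ x v, ∃ w, α (.var x v) = .var (π x) w) {c d : {c // c ∈ φ.clauses}}
    {a b a' b' : ZMod 2} (h : α (.cl c a b) = .cl d a' b') :
    clauseVars d = (clauseVars c).map π.toEmbedding := by
  refine (Finset.eq_of_subset_of_card_le ?_ ?_).symm
  · intro y hy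
    obtain ⟨x, hx, rfl⟩ := Finset.mem_map.1 hy
    obtain ⟨v, hv⟩ := (mem_clauseVars_iff_exists_adj a b).1 hx
    obtain ⟨w, hw⟩ := hπ x v
    have hadj := α.map_adj_iff.2 hv
    rw [h, hw] at hadj
    exact (mem_clauseVars_iff_exists_adj a' b').2 ⟨w, hadj⟩
  · rw [Finset.card_map, card_clauseVars, card_clauseVars]

/-- Automorphisms fix every variable pair and every clause gadget setwise. -/
lemma G1_aut_fixes_gadgets (hasym : ∀ β : Inc φ ≃g Inc φ, ∀ v, β v = v) (α : G1 φ ≃g G1 φ) :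
    (∀ x v, ∃ w, α (.var x v) = .var x w) ∧ ∀ c a b, ∃ a' b', α (.cl c a b) = .cl c a' b' := by
  obtain ⟨π, hπ⟩ := exists_variable_perm hasym α
  choose δ p q hδ using fun c => exists_apply_cl hasym α c 0 0
  have hvars := fun c => clauseVars_eq_map hπ (hδ c)
  have hinj : Function.Injective δ := fun c d h => by
    apply clauseVars_injective
    rw [← Finset.map_inj (f := π.toEmbedding), ← hvars, ← hvars, h]
  let β := incIso (.ofBijective δ (Finite.injective_iff_bijective.1 hinj)) π fun c x => by
    simp [hvars]
  obtain rfl : π = Equiv.refl _ := Equiv.ext fun x => Sum.inr.inj (hasym β (.inr x))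
  refine ⟨fun x v => hπ x v, fun c a b => ?_⟩
  obtain ⟨d, a', b', h⟩ := exists_apply_cl hasym α c a b
  obtain rfl : d = c := by
    apply clauseVars_injective
    rw [clauseVars_eq_map hπ h]
    simp
  exact ⟨a', b', h⟩

end HomXor

open HomXor in
/-- If the bipartite incidence graph `Φ` of the homogeneous 3-XOR formula `φ`
is asymmetric, then every automorphism of `G¹_φ` equals `α_T` for some
satisfying assignment `T` of `φ`. -/
theorem automorphism_of_G1_is_alphaMap {n : ℕ} (φ : HomXor n)
    (hasym : ∀ β : Inc φ ≃g Inc φ, ∀ v, β v = v) (α : G1 φ ≃g G1 φ) :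
    ∃ T : Fin n → ZMod 2, φ.Satisfies T ∧ ⇑α = alphaMap1 φ T := by
  obtain ⟨hvar, hcl⟩ := G1_aut_fixes_gadgets hasym α
  choose T hT₀ using fun x => hvar x 0
  have hT : ∀ x v, α (.var x v) = .var x (v + T x) := by
    intro x v
    obtain rfl | rfl := eq_or_eq_one_add 0 v
    · simpa using hT₀ x
    · obtain ⟨w, hw⟩ := hvar x (1 + 0)
      have hadj := α.map_adj_iff.2 (G1_adj_var_var (φ := φ) (x := x) (v := 0).2 ⟨rfl, rfl⟩)
      rw [hT₀, hw, G1_adj_var_var] at hadj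
      rw [hw, hadj.2, add_zero]
  have key : ∀ c a b, α (.cl c a b) = .cl c (a + T c.1.1) (b + T c.1.2.1) ∧
      T c.1.1 + T c.1.2.1 + T c.1.2.2 = 0 := by
    intro c a b
    obtain ⟨h₁, h₂⟩ := φ.ordered c.1 c.2
    obtain ⟨a', b', h⟩ := hcl c a b
    have hx := α.map_adj_iff.2 (G1_adj_cl_var.2 (.inl ⟨rfl, rfl⟩) :
      (G1 φ).Adj (.cl c a b) (.var c.1.1 (1 + a)))
    have hy := α.map_adj_iff.2 (G1_adj_cl_var.2 (.inr (.inl ⟨rfl, rfl⟩)) :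
      (G1 φ).Adj (.cl c a b) (.var c.1.2.1 (1 + b)))
    have hz := α.map_adj_iff.2 (G1_adj_cl_var.2 (.inr (.inr ⟨rfl, rfl⟩)) :
      (G1 φ).Adj (.cl c a b) (.var c.1.2.2 (1 + a + b)))
    rw [h, hT, G1_adj_cl_var] at hx hy hz
    simp only [h₁.ne, h₁.ne', h₂.ne, h₂.ne', (h₁.trans h₂).ne, (h₁.trans h₂).ne', false_and,
      true_and, or_false, false_or, add_assoc, add_right_inj] at hx hy hz
    subst hx hy
    refine ⟨h, ?_⟩
    linear_combination hz + (T c.1.1 + T c.1.2.1) * (CharTwo.two_eq_zero : (2 : ZMod 2) = 0)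
  refine ⟨T, fun c hc => (key ⟨c, hc⟩ 0 0).2, funext ?_⟩
  rintro (⟨c, a, b⟩ | ⟨x, v⟩)
  · exact (key c a b).1
  · exact hT x v
end
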